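/- arXiv:2205.06860 — 8 statements merged into one kernel-verified Lean document; each statement's English description precedes it below -/
import Mathlib

section
/- Let H be a real Hilbert space, let A : H → Set H be a monotone set-valued operator, and let z, y ∈ H. Let 0 < γ₁ ≤ γ₂ and let x₁, x₂ ∈ H satisfy z − γᵢ y − xᵢ ∈ γᵢ • A xᵢ for i = 1, 2 (i.e., xᵢ = J_{γᵢA}(z − γᵢ y)). Then ‖z − x₂‖/γ₂ ≤ ‖z − x₁‖/γ₁; that is, the function φ_{z,y} : γ ↦ ‖z − J_{γA}(z − γy)‖/γ is nonincreasing. -/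
open scoped Pointwise RealInnerProductSpace

/-- The function `γ ↦ ‖z − J_{γA}(z − γy)‖/γ` is nonincreasing for a monotone
operator `A`. -/
theorem stmt_0 {H : Type*} [NormedAddCommGroup H] [InnerProductSpace ℝ H]
    [CompleteSpace H]
    (A : H → Set H)
    (hmono : ∀ a u b v, u ∈ A a → v ∈ A b → 0 ≤ ⟪a - b, u - v⟫)
    (z y : H) (γ₁ γ₂ : ℝ) (hγ₁ : 0 < γ₁) (hγ : γ₁ ≤ γ₂)
    (x₁ x₂ : H)
    (hx₁ : z - γ₁ • y - x₁ ∈ γ₁ • A x₁)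
    (hx₂ : z - γ₂ • y - x₂ ∈ γ₂ • A x₂) :
    ‖z - x₂‖ / γ₂ ≤ ‖z - x₁‖ / γ₁ := by
  obtain ⟨u₁, hu₁, h₁⟩ := hx₁
  obtain ⟨u₂, hu₂, h₂⟩ := hx₂
  have hγ₂ : 0 < γ₂ := hγ₁.trans_le hγ
  have e₁ : z - x₁ = γ₁ • (u₁ + y) := by
    simp only at h₁
    rw [smul_add, h₁]; abel
  have e₂ : z - x₂ = γ₂ • (u₂ + y) := by
    simp only at h₂
    rw [smul_add, h₂]; abel
  have h := hmono x₁ u₁ x₂ u₂ hu₁ hu₂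
  have hx : x₁ - x₂ = γ₂ • (u₂ + y) - γ₁ • (u₁ + y) := by
    rw [← e₁, ← e₂]; abel
  have hu : u₁ - u₂ = (u₁ + y) - (u₂ + y) := by abel
  rw [hx, hu] at h
  rw [e₁, e₂, norm_smul, norm_smul, Real.norm_of_nonneg hγ₁.le, Real.norm_of_nonneg hγ₂.le,
    mul_div_cancel_left₀ _ hγ₁.ne', mul_div_cancel_left₀ _ hγ₂.ne']
  generalize u₁ + y = p at h ⊢
  generalize u₂ + y = q at h ⊢
  simp only [inner_sub_left, inner_sub_right, real_inner_smul_left,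
    real_inner_self_eq_norm_sq, real_inner_comm p q] at h
  have hcs := mul_le_mul_of_nonneg_left (real_inner_le_norm p q) (add_pos hγ₁ hγ₂).le
  by_contra! hlt
  have hpos : 0 < γ₂ * ‖q‖ - γ₁ * ‖p‖ := by
    nlinarith [norm_nonneg p, norm_nonneg q]
  nlinarith [mul_pos hpos (sub_pos.2 hlt)]
end

section
/- Let H be a real Hilbert space, let A : H → Set H be maximally monotone, let y ∈ H, and let z ∈ dom A (i.e., A z ≠ ∅). Let x : ℝ → H be such that for every γ > 0, z − γ y − x(γ) ∈ γ • A (x(γ)). Then the infimum m = inf {‖u + y‖ : u ∈ A z} is attained by some u ∈ A z, and ‖z − x(γ)‖/γ → m as γ → 0⁺ (i.e., the limit of the function γ ↦ ‖z − x(γ)‖/γ along the filter of positive reals tending to 0 exists and equals the minimal norm of elements of A z + y). -/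
open scoped Pointwise RealInnerProductSpace Topology

/-- Monotonicity of the resolvent graph at parameters `0 < s ≤ t` controls the increments of the
Yosida approximation by the increments of its squared norm. -/
lemma norm_sub_sq_le_of_inner_smul_sub_nonneg {H : Type*} [NormedAddCommGroup H]
    [InnerProductSpace ℝ H] {a b : H} {s t : ℝ} (hs : 0 < s) (hst : s ≤ t)
    (h : 0 ≤ ⟪t • b - s • a, a - b⟫) : ‖a - b‖ ^ 2 ≤ ‖a‖ ^ 2 - ‖b‖ ^ 2 := by
  have hexp : ⟪t • b - s • a, a - b⟫ = (s + t) * ⟪a, b⟫ - s * ‖a‖ ^ 2 - t * ‖b‖ ^ 2 := by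
    simp only [inner_sub_left, inner_sub_right, real_inner_smul_left, real_inner_self_eq_norm_sq,
      real_inner_comm a b]
    ring
  rw [hexp] at h
  have hsub := norm_sub_sq_real a b
  have hnonneg := sq_nonneg ‖a - b‖
  have hkey : (s + t) * ‖a - b‖ ^ 2 ≤ (t - s) * (‖a‖ ^ 2 - ‖b‖ ^ 2) := by
    rw [hsub]; linarith
  rcases hst.eq_or_lt with rfl | hlt
  · have hzero : ‖a - b‖ ^ 2 = 0 := by nlinarith
    rw [sub_eq_zero.1 (norm_eq_zero.1 (pow_eq_zero_iff two_ne_zero |>.1 hzero))]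
    simp
  · have hpos : 0 < s + t := by linarith
    have hdiff : 0 ≤ ‖a‖ ^ 2 - ‖b‖ ^ 2 :=
      nonneg_of_mul_nonneg_right ((mul_nonneg hpos.le hnonneg).trans hkey) (sub_pos.2 hlt)
    refine le_of_mul_le_mul_left (hkey.trans ?_) hpos
    exact mul_le_mul_of_nonneg_right (by linarith) hdiff

/-- A bounded family on the positive reals whose squared increments are dominated by the decrease
of its squared norm converges at `0⁺`. -/
lemma exists_tendsto_of_norm_sub_sq_le {H : Type*} [NormedAddCommGroup H] [CompleteSpace H]
    {q : ℝ → H} {C : ℝ}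
    (hC : ∀ t > 0, ‖q t‖ ≤ C)
    (hq : ∀ s > 0, ∀ t, s ≤ t → ‖q s - q t‖ ^ 2 ≤ ‖q s‖ ^ 2 - ‖q t‖ ^ 2) :
    ∃ p, Filter.Tendsto q (𝓝[>] 0) (𝓝 p) := by
  have hanti : AntitoneOn (fun t => ‖q t‖ ^ 2) (Set.Ioi 0) := fun s hs t _ hst =>
    sub_nonneg.1 ((sq_nonneg _).trans (hq s hs t hst))
  have hbdd : BddAbove ((fun t => ‖q t‖ ^ 2) '' Set.Ioi 0) := by
    refine ⟨C ^ 2, ?_⟩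
    rintro _ ⟨t, ht, rfl⟩
    exact pow_le_pow_left₀ (norm_nonneg _) (hC t ht) 2
  have hlim := hanti.tendsto_nhdsGT hbdd
  have hsqrt : Filter.Tendsto
      (fun r : ℝ × ℝ => √(dist (‖q r.1‖ ^ 2) (‖q r.2‖ ^ 2))) (𝓝[>] 0 ×ˢ 𝓝[>] 0) (𝓝 0) := by
    have h := ((hlim.comp Filter.tendsto_fst).dist (hlim.comp Filter.tendsto_snd)).sqrt
    simpa only [dist_self, Real.sqrt_zero, Function.comp_apply] using h
  have hcauchy : Cauchy (Filter.map q (𝓝[>] 0)) := by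
    rw [cauchy_map_iff', tendsto_uniformity_iff_dist_tendsto_zero]
    refine squeeze_zero' (.of_forall fun _ => dist_nonneg) ?_ hsqrt
    have hpos : ∀ᶠ t : ℝ in 𝓝[>] 0, 0 < t := self_mem_nhdsWithin
    filter_upwards [hpos.prod_mk hpos] with ⟨s, t⟩ ⟨hs, ht⟩
    refine Real.le_sqrt_of_sq_le ?_
    rw [Real.dist_eq, dist_eq_norm]
    rcases le_total s t with hst | hst
    · exact (hq s hs t hst).trans (le_abs_self _)
    · rw [norm_sub_rev, abs_sub_comm]
      exact (hq t ht s hst).trans (le_abs_self _)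
  exact CompleteSpace.complete hcauchy

/-- For a maximally monotone operator `A` and `z ∈ dom A`, the quotient
`‖z − J_{γA}(z − γy)‖/γ` tends, as `γ ↓ 0`, to the minimal norm of elements of
`A z + y`, and this minimum is attained. -/
theorem stmt_2 {H : Type*} [NormedAddCommGroup H] [InnerProductSpace ℝ H]
    [CompleteSpace H]
    (A : H → Set H)
    (hmono : ∀ a u b v, u ∈ A a → v ∈ A b → 0 ≤ ⟪a - b, u - v⟫)
    (hmax : ∀ a u, (∀ b v, v ∈ A b → 0 ≤ ⟪a - b, u - v⟫) → u ∈ A a)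
    (z y : H) (hz : (A z).Nonempty)
    (x : ℝ → H)
    (hx : ∀ γ > (0 : ℝ), z - γ • y - x γ ∈ γ • A (x γ)) :
    ∃ u ∈ A z, (∀ w ∈ A z, ‖u + y‖ ≤ ‖w + y‖) ∧
      Filter.Tendsto (fun γ : ℝ => ‖z - x γ‖ / γ) (𝓝[>] 0) (𝓝 ‖u + y‖) := by
  set q : ℝ → H := fun γ => γ⁻¹ • (z - x γ) with hq
  have hxq : ∀ γ > 0, x γ = z - γ • q γ := fun γ hγ => by
    simp [hq, smul_inv_smul₀ hγ.ne']
  have hmem : ∀ γ > 0, q γ - y ∈ A (x γ) := fun γ hγ => by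
    have h := (Set.mem_smul_set_iff_inv_smul_mem₀ hγ.ne' _ _).1 (hx γ hγ)
    rwa [sub_right_comm, smul_sub, inv_smul_smul₀ hγ.ne'] at h
  have hbound : ∀ w ∈ A z, ∀ γ > 0, ‖q γ‖ ≤ ‖w + y‖ := fun w hw γ hγ => by
    have h := hmono _ _ _ _ hw (hmem γ hγ)
    rw [hxq γ hγ, sub_sub_cancel, real_inner_smul_left, ← sub_add, sub_add_eq_add_sub,
      inner_sub_right, real_inner_self_eq_norm_sq] at h
    have h' := nonneg_of_mul_nonneg_right h hγ
    have hcs := real_inner_le_norm (q γ) (w + y)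
    by_contra! hlt
    nlinarith [norm_nonneg (w + y)]
  obtain ⟨w₀, hw₀⟩ := hz
  obtain ⟨p, hp⟩ := exists_tendsto_of_norm_sub_sq_le (hbound w₀ hw₀) fun s hs t hst => by
    refine norm_sub_sq_le_of_inner_smul_sub_nonneg hs hst ?_
    have h := hmono _ _ _ _ (hmem s hs) (hmem t (hs.trans_le hst))
    rwa [hxq s hs, hxq t (hs.trans_le hst), sub_sub_sub_cancel_left, sub_sub_sub_cancel_right] at h
  have hpos : ∀ᶠ γ : ℝ in 𝓝[>] 0, 0 < γ := self_mem_nhdsWithin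
  have hxz : Filter.Tendsto x (𝓝[>] 0) (𝓝 z) := by
    have hid : Filter.Tendsto (fun γ : ℝ => γ) (𝓝[>] 0) (𝓝 0) := nhdsWithin_le_nhds
    have h := (tendsto_const_nhds (x := z)).sub (hid.smul hp)
    rw [zero_smul, sub_zero] at h
    exact h.congr' (hpos.mono fun γ hγ => (hxq γ hγ).symm)
  refine ⟨p - y, hmax _ _ fun b v hv => ?_, fun w hw => ?_, ?_⟩
  · exact ge_of_tendsto ((hxz.sub_const b).inner ((hp.sub_const y).sub_const v))
      (hpos.mono fun γ hγ => hmono _ _ _ _ (hmem γ hγ) hv)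
  · rw [sub_add_cancel]
    exact le_of_tendsto hp.norm (hpos.mono (hbound w hw))
  · rw [sub_add_cancel]
    refine hp.norm.congr' (hpos.mono fun γ hγ => ?_)
    simp only [hq, norm_smul, norm_inv, Real.norm_of_nonneg hγ.le]
    rw [inv_mul_eq_div]
end

section
/- Let H be a real Hilbert space, let A : H → Set H be maximally monotone with dom A ≠ ∅, let y ∈ H, let z ∈ H, and let x : ℝ → H be such that for every γ > 0, z − γ y − x(γ) ∈ γ • A (x(γ)). Then: (i) if z ∈ dom A, there exists M ≥ 0 such that ‖z − x(γ)‖/γ ≤ M for all γ > 0; and (ii) conversely, if there exists M ≥ 0 such that ‖z − x(γ)‖/γ ≤ M for all γ ∈ (0,1], then z belongs to the closure of dom A. In other words, dom A ⊆ 𝒞 ⊆ closure(dom A), where 𝒞 = {z ∈ H : lim_{γ↓0} ‖z − J_{γA}(z − γy)‖/γ < +∞}. -/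
open scoped Pointwise RealInnerProductSpace

/-- The displacement of a resolvent step from a point `z` with `v ∈ A z` is at most
`γ * ‖y + v‖`; here `u ∈ A p` is the element realising the resolvent step to `p`. -/
lemma norm_sub_div_le_of_resolvent_step {H : Type*} [NormedAddCommGroup H]
    [InnerProductSpace ℝ H] {y z p u v : H} {γ : ℝ} (hγ : 0 < γ)
    (hmono : 0 ≤ ⟪p - z, u - v⟫) (hu : γ • u = z - γ • y - p) :
    ‖z - p‖ / γ ≤ ‖y + v‖ := by
  have hstep : γ • (u - v) = (z - p) - γ • (y + v) := by
    rw [smul_sub, hu, smul_add]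
    abel
  have hsq : ‖z - p‖ * ‖z - p‖ ≤ γ * ⟪z - p, y + v⟫ := by
    have h : 0 ≤ ⟪p - z, γ • (u - v)⟫ := by
      rw [real_inner_smul_right]
      positivity
    rw [hstep, ← neg_sub z p, inner_neg_left, inner_sub_right, real_inner_smul_right,
      real_inner_self_eq_norm_mul_norm] at h
    linarith
  rw [div_le_iff₀ hγ]
  rcases (norm_nonneg (z - p)).eq_or_lt with h0 | hpos
  · rw [← h0]
    positivity
  · refine le_of_mul_le_mul_left ?_ hpos
    calc ‖z - p‖ * ‖z - p‖ ≤ γ * ⟪z - p, y + v⟫ := hsq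
      _ ≤ γ * (‖z - p‖ * ‖y + v‖) := by
        gcongr
        exact real_inner_le_norm _ _
      _ = ‖z - p‖ * (‖y + v‖ * γ) := by ring

/-- `dom A ⊆ 𝒞 ⊆ closure (dom A)`, where `𝒞` is the set of points `z` at which
`γ ↦ ‖z − J_{γA}(z − γy)‖/γ` stays bounded as `γ ↓ 0`. -/
theorem stmt_3 {H : Type*} [NormedAddCommGroup H] [InnerProductSpace ℝ H]
    [CompleteSpace H]
    (A : H → Set H)
    (hmono : ∀ a u b v, u ∈ A a → v ∈ A b → 0 ≤ ⟪a - b, u - v⟫)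
    (hmax : ∀ a u, (∀ b v, v ∈ A b → 0 ≤ ⟪a - b, u - v⟫) → u ∈ A a)
    (hdom : {w : H | (A w).Nonempty}.Nonempty)
    (y z : H) (x : ℝ → H)
    (hx : ∀ γ > (0 : ℝ), z - γ • y - x γ ∈ γ • A (x γ)) :
    ((A z).Nonempty → ∃ M : ℝ, 0 ≤ M ∧ ∀ γ > (0 : ℝ), ‖z - x γ‖ / γ ≤ M) ∧
    ((∃ M : ℝ, 0 ≤ M ∧ ∀ γ ∈ Set.Ioc (0 : ℝ) 1, ‖z - x γ‖ / γ ≤ M) →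
      z ∈ closure {w : H | (A w).Nonempty}) := by
  refine ⟨?_, ?_⟩
  · rintro ⟨v, hv⟩
    refine ⟨‖y + v‖, norm_nonneg _, fun γ hγ => ?_⟩
    obtain ⟨u, hu, hstep⟩ := Set.mem_smul_set.1 (hx γ hγ)
    exact norm_sub_div_le_of_resolvent_step hγ (hmono _ _ _ _ hu hv) hstep
  · rintro ⟨M, hM, hbound⟩
    refine Metric.mem_closure_iff.2 fun ε hε => ?_
    have hM1 : 0 < M + 1 := by linarith
    obtain ⟨γ, hγ, hγlt⟩ := exists_between (lt_min one_pos (div_pos hε hM1))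
    obtain ⟨u, hu, -⟩ := Set.mem_smul_set.1 (hx γ hγ)
    refine ⟨x γ, ⟨u, hu⟩, ?_⟩
    have hle := (div_le_iff₀ hγ).1 (hbound γ ⟨hγ, (hγlt.trans_le (min_le_left _ _)).le⟩)
    have hlt := (lt_div_iff₀ hM1).1 (hγlt.trans_le (min_le_right _ _))
    rw [dist_eq_norm]
    linarith
end

section
/- Let H be a real Hilbert space, let A : H → Set H be monotone, let z, y ∈ H, and let x : ℝ → H be such that for every γ > 0, z − γ y − x(γ) ∈ γ • A (x(γ)). Assume there exists M ≥ 0 such that ‖z − x(γ)‖/γ ≤ M for all γ ∈ (0,1], and let B₃ : H → H be continuous at z. Then for every θ ∈ (0,1) there exists γ̄ > 0 such that for all γ ∈ (0, γ̄], γ‖B₃ z − B₃(x(γ))‖ ≤ θ‖z − x(γ)‖. -/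
open scoped Pointwise RealInnerProductSpace

/-- For a monotone operator `A`, the quotient `‖z - J_{γA}(z - γy)‖ / γ` is nonincreasing
in `γ`. -/
theorem norm_sub_resolvent_div_antitone {H : Type*} [NormedAddCommGroup H]
    [InnerProductSpace ℝ H] {A : H → Set H}
    (hmono : ∀ a u b v, u ∈ A a → v ∈ A b → 0 ≤ ⟪a - b, u - v⟫)
    {z y a b : H} {s t : ℝ} (hs : 0 < s) (hst : s ≤ t)
    (ha : z - s • y - a ∈ s • A a) (hb : z - t • y - b ∈ t • A b) :
    ‖z - b‖ / t ≤ ‖z - a‖ / s := by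
  have ht : 0 < t := hs.trans_le hst
  obtain ⟨u, hu, hua⟩ := ha
  obtain ⟨v, hv, hvb⟩ := hb
  replace hua : z - a = s • (u + y) := by
    rw [smul_add, show s • u = z - s • y - a from hua]; abel
  replace hvb : z - b = t • (v + y) := by
    rw [smul_add, show t • v = z - t • y - b from hvb]; abel
  have h := hmono a u b v hu hv
  have hab : a - b = t • (v + y) - s • (u + y) := by rw [← hua, ← hvb]; abel
  have huv : u - v = (u + y) - (v + y) := by abel
  rw [hua, hvb, norm_smul, norm_smul, Real.norm_of_nonneg hs.le, Real.norm_of_nonneg ht.le,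
    mul_div_cancel_left₀ _ ht.ne', mul_div_cancel_left₀ _ hs.ne']
  rw [hab, huv] at h
  generalize u + y = p at h ⊢
  generalize v + y = q at h ⊢
  simp only [inner_sub_left, inner_sub_right, real_inner_smul_left,
    real_inner_self_eq_norm_sq, real_inner_comm p q] at h
  by_contra! hlt
  have hpq := mul_le_mul_of_nonneg_left (real_inner_le_norm p q) (add_pos hs ht).le
  have hscale : s * ‖p‖ < t * ‖q‖ :=
    (mul_lt_mul_of_pos_left hlt hs).trans_le (mul_le_mul_of_nonneg_right hst (norm_nonneg q))
  have hprod := mul_pos (sub_pos.2 hlt) (sub_pos.2 hscale)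
  nlinarith

/-- If the quotient `‖z − J_{γA}(z − γy)‖/γ` stays bounded as `γ ↓ 0` and `B₃`
is continuous at `z`, then the line-search inequality
`γ‖B₃z − B₃ x(γ)‖ ≤ θ‖z − x(γ)‖` holds for all sufficiently small `γ > 0`. -/
theorem stmt_4 {H : Type*} [NormedAddCommGroup H] [InnerProductSpace ℝ H]
    [CompleteSpace H]
    (A : H → Set H)
    (hmono : ∀ a u b v, u ∈ A a → v ∈ A b → 0 ≤ ⟪a - b, u - v⟫)
    (z y : H) (x : ℝ → H)
    (hx : ∀ γ > (0 : ℝ), z - γ • y - x γ ∈ γ • A (x γ))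
    (M : ℝ) (hM : 0 ≤ M)
    (hbd : ∀ γ ∈ Set.Ioc (0 : ℝ) 1, ‖z - x γ‖ / γ ≤ M)
    (B₃ : H → H) (hB₃ : ContinuousAt B₃ z) :
    ∀ θ ∈ Set.Ioo (0 : ℝ) 1, ∃ γbar > (0 : ℝ), ∀ γ ∈ Set.Ioc (0 : ℝ) γbar,
      γ * ‖B₃ z - B₃ (x γ)‖ ≤ θ * ‖z - x γ‖ := by
  rintro θ ⟨hθ, -⟩
  by_cases hz : ∀ γ ∈ Set.Ioc (0 : ℝ) 1, x γ = z
  · exact ⟨1, one_pos, fun γ hγ => by simp [hz γ hγ]⟩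
  push Not at hz
  obtain ⟨γ₀, hγ₀, hne⟩ := hz
  set c := ‖z - x γ₀‖ / γ₀
  have hcpos : 0 < c := div_pos (norm_pos_iff.2 (sub_ne_zero.2 hne.symm)) hγ₀.1
  obtain ⟨δ, hδ, hB⟩ := Metric.continuousAt_iff.1 hB₃ (θ * c) (mul_pos hθ hcpos)
  have hM1 : 0 < M + 1 := by linarith
  refine ⟨min γ₀ (δ / (M + 1)), lt_min hγ₀.1 (div_pos hδ hM1), fun γ ⟨hγ, hγle⟩ => ?_⟩
  have hγγ₀ : γ ≤ γ₀ := hγle.trans (min_le_left _ _)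
  have hγδ : γ * (M + 1) ≤ δ := (le_div_iff₀ hM1).1 (hγle.trans (min_le_right _ _))
  have hupper : ‖z - x γ‖ ≤ M * γ := (div_le_iff₀ hγ).1 (hbd γ ⟨hγ, hγγ₀.trans hγ₀.2⟩)
  have hlower : c * γ ≤ ‖z - x γ‖ := (le_div_iff₀ hγ).1
    (norm_sub_resolvent_div_antitone hmono hγ hγγ₀ (hx γ hγ) (hx γ₀ hγ₀.1))
  have hclose : ‖B₃ z - B₃ (x γ)‖ < θ * c := by
    rw [← dist_eq_norm, dist_comm]
    apply hB
    rw [dist_comm, dist_eq_norm]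
    linarith
  calc γ * ‖B₃ z - B₃ (x γ)‖ ≤ γ * (θ * c) := by gcongr
    _ = θ * (c * γ) := by ring
    _ ≤ θ * ‖z - x γ‖ := by gcongr
end

section
/- Let H be a real Hilbert space, let A : H → Set H be maximally monotone with dom A ≠ ∅, let z, y ∈ H, and let x : ℝ → H satisfy, for every γ > 0, z − γ y − x(γ) ∈ γ • A (x(γ)). Assume D := closure(dom A) is convex (this holds automatically for maximally monotone A), let p be the metric projection of z onto D, and assume that ‖z − x(γ)‖/γ → +∞ as γ → 0⁺. Let B₃ : H → H be locally bounded at p, i.e., there exists δ > 0 such that B₃ maps the open ball of center p and radius δ onto a bounded set. Then for every θ ∈ (0,1) there exists γ̄ > 0 such that for all γ ∈ (0, γ̄], γ‖B₃ z − B₃(x(γ))‖ ≤ θ‖z − x(γ)‖. -/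
open scoped Pointwise RealInnerProductSpace Topology

/-- If `D` contains `dom A` and `p` is a point of `D` with the variational property of the
projection of `z`, then comparing a resolvent value `x` with a point `(b, v)` of the graph of `A`
controls the distance from `x` to `p`. -/
theorem norm_sub_sq_le_of_resolvent {H : Type*} [NormedAddCommGroup H] [InnerProductSpace ℝ H]
    {A : H → Set H}
    (hmono : ∀ a u b v, u ∈ A a → v ∈ A b → 0 ≤ ⟪a - b, u - v⟫)
    {z y x p b v : H} {γ : ℝ} (hγ : 0 < γ)
    (hx : z - γ • y - x ∈ γ • A x) (hproj : ⟪z - p, x - p⟫ ≤ 0) (hv : v ∈ A b) :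
    ‖x - p‖ ^ 2 ≤ ‖b - p‖ * (‖z - p‖ + ‖x - p‖) + γ * ‖y + v‖ * (‖x - p‖ + ‖b - p‖) := by
  obtain ⟨u, hu, hux : γ • u = z - γ • y - x⟩ := hx
  have hmon : 0 ≤ ⟪x - b, (z - γ • y - x) - γ • v⟫ := by
    rw [← hux, ← smul_sub, real_inner_smul_right]
    exact mul_nonneg hγ.le (hmono x u b v hu hv)
  have hsplit : ⟪x - b, (z - γ • y - x) - γ • v⟫ =
      ⟪z - p, x - p⟫ - ‖x - p‖ ^ 2 - ⟪b - p, (z - p) - (x - p)⟫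
        - γ * ⟪(x - p) - (b - p), y + v⟫ := by
    rw [show x - b = (x - p) - (b - p) by abel,
      show (z - γ • y - x) - γ • v = (z - p) - (x - p) - γ • (y + v) by rw [smul_add]; abel]
    generalize x - p = r
    generalize b - p = e
    generalize z - p = k
    rw [← real_inner_self_eq_norm_sq]
    simp only [inner_sub_left, inner_sub_right, real_inner_smul_right, real_inner_comm k r]
    ring
  have hbound₁ : -⟪b - p, (z - p) - (x - p)⟫ ≤ ‖b - p‖ * (‖z - p‖ + ‖x - p‖) :=
    (neg_le_abs _).trans <| (abs_real_inner_le_norm _ _).trans <| by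
      gcongr
      exact norm_sub_le _ _
  have hbound₂ : -⟪(x - p) - (b - p), y + v⟫ ≤ (‖x - p‖ + ‖b - p‖) * ‖y + v‖ :=
    (neg_le_abs _).trans <| (abs_real_inner_le_norm _ _).trans <| by
      gcongr
      exact norm_sub_le _ _
  nlinarith [mul_le_mul_of_nonneg_left hbound₂ hγ.le]

/-- The resolvent values `J_{γA}(z - γ y)` converge, as `γ ↓ 0`, to the projection of `z` onto the
closure of `dom A`. -/
theorem tendsto_resolvent_projection {H : Type*} [NormedAddCommGroup H] [InnerProductSpace ℝ H]
    {A : H → Set H}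
    (hmono : ∀ a u b v, u ∈ A a → v ∈ A b → 0 ≤ ⟪a - b, u - v⟫)
    {z y p : H} {x : ℝ → H}
    (hx : ∀ γ > (0 : ℝ), z - γ • y - x γ ∈ γ • A (x γ))
    (hp : p ∈ closure {w : H | (A w).Nonempty})
    (hproj : ∀ c ∈ closure {w : H | (A w).Nonempty}, ⟪z - p, c - p⟫ ≤ 0) :
    Filter.Tendsto x (𝓝[>] 0) (𝓝 p) := by
  rw [Metric.tendsto_nhds]
  intro δ hδ
  set K := ‖z - p‖ with hK
  have hK0 : 0 ≤ K := norm_nonneg _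
  obtain ⟨ε, hε, hεδ, hεK⟩ : ∃ ε > 0, ε ≤ δ / 8 ∧ ε * K ≤ δ ^ 2 / 4 := by
    refine ⟨min (δ / 8) (δ ^ 2 / 4 / (K + 1)), by positivity, min_le_left _ _, ?_⟩
    calc _ ≤ δ ^ 2 / 4 / (K + 1) * (K + 1) := by
          gcongr
          · exact min_le_right _ _
          · linarith
      _ = δ ^ 2 / 4 := by field_simp
  obtain ⟨b, ⟨v, hv⟩, hb⟩ := Metric.mem_closure_iff.1 hp ε hε
  rw [dist_comm, dist_eq_norm] at hb
  have hlim : Filter.Tendsto (fun γ : ℝ => γ * ‖y + v‖) (𝓝[>] 0) (𝓝 0) := by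
    refine Filter.Tendsto.mono_left ?_ nhdsWithin_le_nhds
    simpa using (continuous_mul_const ‖y + v‖).tendsto 0
  filter_upwards [self_mem_nhdsWithin, hlim.eventually (gt_mem_nhds hε)] with γ hγ hγε
  have hxD : x γ ∈ closure {w : H | (A w).Nonempty} :=
    subset_closure (Set.smul_set_nonempty.1 ⟨_, hx γ hγ⟩)
  have hle := norm_sub_sq_le_of_resolvent hmono hγ (hx γ hγ) (hproj _ hxD) hv
  rw [dist_eq_norm]
  by_contra! hr
  have hle' : ‖x γ - p‖ ^ 2 ≤ ε * (K + ‖x γ - p‖) + ε * (‖x γ - p‖ + ε) :=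
    hle.trans (by gcongr)
  nlinarith [mul_le_mul hεδ hr hδ.le (by positivity)]

/-- If `‖z − J_{γA}(z − γy)‖/γ → +∞` as `γ ↓ 0` and `B₃` is locally bounded at
the projection `p` of `z` onto the closure of `dom A`, then the line-search
inequality `γ‖B₃z − B₃ x(γ)‖ ≤ θ‖z − x(γ)‖` holds for all small `γ > 0`. -/
theorem stmt_5 {H : Type*} [NormedAddCommGroup H] [InnerProductSpace ℝ H]
    [CompleteSpace H]
    (A : H → Set H)
    (hmono : ∀ a u b v, u ∈ A a → v ∈ A b → 0 ≤ ⟪a - b, u - v⟫)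
    (hmax : ∀ a u, (∀ b v, v ∈ A b → 0 ≤ ⟪a - b, u - v⟫) → u ∈ A a)
    (hdom : {w : H | (A w).Nonempty}.Nonempty)
    (z y : H) (x : ℝ → H)
    (hx : ∀ γ > (0 : ℝ), z - γ • y - x γ ∈ γ • A (x γ))
    (D : Set H) (hD : D = closure {w : H | (A w).Nonempty}) (hDconv : Convex ℝ D)
    (p : H) (hpD : p ∈ D) (hproj : ∀ c ∈ D, ⟪z - p, c - p⟫ ≤ 0)
    (hblow : Filter.Tendsto (fun γ : ℝ => ‖z - x γ‖ / γ) (𝓝[>] 0) Filter.atTop)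
    (B₃ : H → H)
    (hloc : ∃ δ > (0 : ℝ), ∃ C : ℝ, ∀ w ∈ Metric.ball p δ, ‖B₃ w‖ ≤ C) :
    ∀ θ ∈ Set.Ioo (0 : ℝ) 1, ∃ γbar > (0 : ℝ), ∀ γ ∈ Set.Ioc (0 : ℝ) γbar,
      γ * ‖B₃ z - B₃ (x γ)‖ ≤ θ * ‖z - x γ‖ := by
  rintro θ ⟨hθ, -⟩
  subst hD
  obtain ⟨δ, hδ, C, hC⟩ := hloc
  have hnear := (tendsto_resolvent_projection hmono hx hpD hproj).eventually
    (Metric.ball_mem_nhds p hδ)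
  have hlarge := hblow.eventually_ge_atTop ((‖B₃ z‖ + C) / θ)
  obtain ⟨γbar, hγbar, hsub⟩ := mem_nhdsGT_iff_exists_Ioc_subset.1 (hnear.and hlarge)
  refine ⟨γbar, hγbar, fun γ hγ => ?_⟩
  obtain ⟨hball, hge⟩ := hsub hγ
  have hγ0 : 0 < γ := hγ.1
  rw [div_le_div_iff₀ hθ hγ0] at hge
  calc γ * ‖B₃ z - B₃ (x γ)‖ ≤ γ * (‖B₃ z‖ + C) := by
        gcongr
        exact (norm_sub_le _ _).trans (by gcongr; exact hC _ hball)
    _ ≤ θ * ‖z - x γ‖ := by linarith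
end

section
/- Let H be a real Hilbert space, let A : H → Set H be monotone, let β > 0, L > 0, let B₁ : H → H be β-cocoercive, let B₂ : H → H be monotone and L-Lipschitzian, let B₃ : H → H be monotone, and let X ⊆ H be a nonempty closed convex set. Let ε ∈ (0,1), set ρ = min{2βε, √(1−ε)/L}, let σ ∈ (0,1), let θ > 0, and let γ ∈ (0, ρσ]. Let z ∈ H, let x ∈ H satisfy z − γ(B₁z + B₂z + B₃z) − x ∈ γ • A x, assume the line-search inequality γ‖B₃z − B₃x‖ ≤ θ‖z − x‖, and let z⁺ be the metric projection of x + γ((B₂z + B₃z) − (B₂x + B₃x)) onto X. Then for every z* ∈ X with −(B₁z* + B₂z* + B₃z*) ∈ A z*, one has ‖z⁺ − z*‖² ≤ ‖z − z*‖² − ((1−ε) − (Lρσ + θ)²)‖z − x‖². -/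
open scoped Pointwise RealInnerProductSpace

/-- The distance to a point `c` does not increase when a point `w` is replaced by `q` satisfying the
variational inequality of the projection at `c`. -/
theorem norm_sub_sq_le_of_inner_sub_nonpos {H : Type*} [NormedAddCommGroup H]
    [InnerProductSpace ℝ H] {w q c : H} (h : ⟪w - q, c - q⟫ ≤ 0) :
    ‖q - c‖ ^ 2 ≤ ‖w - c‖ ^ 2 := by
  have e : w - c = (w - q) - (c - q) := by abel
  rw [norm_sub_rev q c, e, norm_sub_sq_real (w - q)]
  nlinarith [sq_nonneg ‖w - q‖]

/-- A cocoercivity estimate combined with Young's inequality. -/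
theorem inner_add_sq_nonneg_of_cocoercive {H : Type*} [NormedAddCommGroup H]
    [InnerProductSpace ℝ H] {β γ ε : ℝ} (hβ : 0 < β) (hγ : 0 < γ) (hγε : γ ≤ 2 * β * ε)
    {b p d : H} (h : β * ‖b‖ ^ 2 ≤ ⟪p, b⟫) :
    0 ≤ 2 * γ * ⟪p - d, b⟫ + ε * ‖d‖ ^ 2 := by
  have hcs : ⟪d, b⟫ ≤ ‖d‖ * ‖b‖ := real_inner_le_norm d b
  have hquad : 0 ≤ 2 * γ * (β * ‖b‖ ^ 2 - ‖d‖ * ‖b‖) + ε * ‖d‖ ^ 2 := by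
    have h1 : 0 ≤ γ * (2 * β * ‖b‖ - ‖d‖) ^ 2 := by positivity
    have h2 : 0 ≤ (2 * β * ε - γ) * ‖d‖ ^ 2 := mul_nonneg (by linarith) (sq_nonneg _)
    refine nonneg_of_mul_nonneg_right (a := 2 * β) ?_ (by positivity)
    linarith
  rw [inner_sub_left]
  have := mul_le_mul_of_nonneg_left (sub_le_sub h hcs) (by positivity : 0 ≤ 2 * γ)
  linarith

/-- One-step Fejér-type descent inequality for the forward–backward–half-forward
step with line search. -/
theorem stmt_7 {H : Type*} [NormedAddCommGroup H] [InnerProductSpace ℝ H]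
    [CompleteSpace H]
    (A : H → Set H)
    (hmono : ∀ a u b v, u ∈ A a → v ∈ A b → 0 ≤ ⟪a - b, u - v⟫)
    (β L : ℝ) (hβ : 0 < β) (hL : 0 < L)
    (B₁ B₂ B₃ : H → H)
    (hB₁ : ∀ a b : H, β * ‖B₁ a - B₁ b‖ ^ 2 ≤ ⟪a - b, B₁ a - B₁ b⟫)
    (hB₂mono : ∀ a b : H, 0 ≤ ⟪a - b, B₂ a - B₂ b⟫)
    (hB₂lip : ∀ a b : H, ‖B₂ a - B₂ b‖ ≤ L * ‖a - b‖)
    (hB₃mono : ∀ a b : H, 0 ≤ ⟪a - b, B₃ a - B₃ b⟫)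
    (X : Set H) (hXne : X.Nonempty) (hXcl : IsClosed X) (hXconv : Convex ℝ X)
    (ε : ℝ) (hε : ε ∈ Set.Ioo (0 : ℝ) 1)
    (ρ : ℝ) (hρ : ρ = min (2 * β * ε) (Real.sqrt (1 - ε) / L))
    (σ : ℝ) (hσ : σ ∈ Set.Ioo (0 : ℝ) 1)
    (θ : ℝ) (hθ : 0 < θ)
    (γ : ℝ) (hγ : γ ∈ Set.Ioc (0 : ℝ) (ρ * σ))
    (z x : H)
    (hx : z - γ • (B₁ z + B₂ z + B₃ z) - x ∈ γ • A x)
    (hls : γ * ‖B₃ z - B₃ x‖ ≤ θ * ‖z - x‖)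
    (zp : H) (hzpX : zp ∈ X)
    (hzproj : ∀ c ∈ X,
      ⟪x + γ • ((B₂ z + B₃ z) - (B₂ x + B₃ x)) - zp, c - zp⟫ ≤ 0) :
    ∀ zs ∈ X, -(B₁ zs + B₂ zs + B₃ zs) ∈ A zs →
      ‖zp - zs‖ ^ 2 ≤ ‖z - zs‖ ^ 2 - ((1 - ε) - (L * ρ * σ + θ) ^ 2) * ‖z - x‖ ^ 2 := by
  intro zs hzs hA
  obtain ⟨hγ0, hγ1⟩ := hγ
  obtain ⟨hσ0, hσ1⟩ := hσ
  obtain ⟨u, hu, hux⟩ := hx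
  have hρ0 : 0 < ρ := pos_of_mul_pos_left (hγ0.trans_le hγ1) hσ0.le
  have hγε : γ ≤ 2 * β * ε := by
    have h1 : ρ ≤ 2 * β * ε := hρ ▸ min_le_left _ _
    nlinarith
  set D : H := (B₂ z + B₃ z) - (B₂ x + B₃ x) with hD
  have hproj := norm_sub_sq_le_of_inner_sub_nonpos (hzproj zs hzs)
  have hDnorm : ‖γ • D‖ ≤ (L * ρ * σ + θ) * ‖z - x‖ := by
    have e : D = (B₂ z - B₂ x) + (B₃ z - B₃ x) := by rw [hD]; abel
    have h1 : γ * ‖B₂ z - B₂ x‖ ≤ (ρ * σ) * (L * ‖z - x‖) :=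
      mul_le_mul hγ1 (hB₂lip z x) (norm_nonneg _) (by positivity)
    have h2 : γ * ‖D‖ ≤ γ * (‖B₂ z - B₂ x‖ + ‖B₃ z - B₃ x‖) := by
      rw [e]
      gcongr
      exact norm_add_le _ _
    rw [norm_smul, Real.norm_of_nonneg hγ0.le]
    linarith
  have hDsq : ‖γ • D‖ ^ 2 ≤ (L * ρ * σ + θ) ^ 2 * ‖z - x‖ ^ 2 := by
    rw [← mul_pow]
    gcongr
  have hcross : 0 ≤ 2 * ⟪(z - x) - γ • D, x - zs⟫ + ε * ‖z - x‖ ^ 2 := by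
    have e : (z - x) - γ • D = γ • ((u - -(B₁ zs + B₂ zs + B₃ zs)) + (B₂ x - B₂ zs)
        + (B₃ x - B₃ zs) + (B₁ z - B₁ zs)) := by
      have hzx : z - x = γ • u + γ • (B₁ z + B₂ z + B₃ z) := by
        have hux' : γ • u = z - γ • (B₁ z + B₂ z + B₃ z) - x := hux
        rw [hux']; abel
      rw [hzx, hD]
      module
    have h0 := inner_add_sq_nonneg_of_cocoercive (d := z - x) hβ hγ0 hγε (hB₁ z zs)
    rw [sub_sub_sub_cancel_left] at h0
    have h1 := hmono x u zs _ hu hA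
    have h2 := hB₂mono x zs
    have h3 := hB₃mono x zs
    rw [e, real_inner_comm, inner_smul_right, inner_add_right, inner_add_right, inner_add_right]
    have h4 := mul_nonneg hγ0.le (add_nonneg (add_nonneg h1 h2) h3)
    linarith
  have hw : ‖x + γ • D - zs‖ ^ 2 = ‖x - zs‖ ^ 2 + 2 * ⟪γ • D, x - zs⟫ + ‖γ • D‖ ^ 2 := by
    rw [add_sub_right_comm, norm_add_sq_real, real_inner_comm]
  have hz : ‖z - zs‖ ^ 2 = ‖z - x‖ ^ 2 + 2 * ⟪z - x, x - zs⟫ + ‖x - zs‖ ^ 2 := by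
    rw [← sub_add_sub_cancel z x zs, norm_add_sq_real]
  rw [inner_sub_left] at hcross
  linarith
end

section
/- Let H be a real Hilbert space, let A : H → Set H be maximally monotone, let β > 0, L > 0, let B₁ : H → H be β-cocoercive, let B₂ : H → H be monotone and L-Lipschitzian, let B₃ : H → H satisfy ⟪a − b, B₃a − B₃b⟫ ≥ 0 for all a, b ∈ dom A ∪ X, and let X ⊆ H be a nonempty closed convex set. Assume the operator x ↦ {u + B₃x : u ∈ A x} is maximally monotone and that Z := {w ∈ X : −(B₁w + B₂w + B₃w) ∈ A w} is nonempty. Write B = B₁ + B₂ + B₃. Let ε ∈ (0,1), ρ = min{2βε, √(1−ε)/L}, σ ∈ (0,1), θ ∈ (0, √(1−ε) − Lρσ). Let sequences (zₙ), (xₙ) in H and (γₙ) in ℝ satisfy: z₀ ∈ X; for every n, γₙ ∈ (0, ρσ], zₙ − γₙ B zₙ − xₙ ∈ γₙ • A xₙ, γₙ‖B₃zₙ − B₃xₙ‖ ≤ θ‖zₙ − xₙ‖, and zₙ₊₁ is the metric projection of xₙ + γₙ((B₂zₙ + B₃zₙ) − (B₂xₙ + B₃xₙ)) onto X. If moreover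 there exist δ > 0 and N such that γₙ ≥ δ for all n ≥ N (i.e., liminf γₙ > 0), then there exists z̄ ∈ Z such that (zₙ) converges weakly to z̄. -/
open scoped Pointwise RealInnerProductSpace

open Filter Topology

section MonotoneOperators

variable {H : Type*} [NormedAddCommGroup H] [InnerProductSpace ℝ H]

/-- On the convex hull of the epigraph of the pairing over a monotone graph, the last coordinate
still dominates the pairing of the first two. -/
lemma inner_le_of_mem_convexHull_graph {M : H → Set H}
    (mono : ∀ a u b v, u ∈ M a → v ∈ M b → 0 ≤ ⟪a - b, u - v⟫) {p : H × H × ℝ}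
    (hp : p ∈ convexHull ℝ {q : H × H × ℝ | q.2.1 ∈ M q.1 ∧ q.2.2 = ⟪q.1, q.2.1⟫}) :
    ⟪p.1, p.2.1⟫ ≤ p.2.2 := by
  set G : Set (H × H × ℝ) := {q | q.2.1 ∈ M q.1 ∧ q.2.2 = ⟪q.1, q.2.1⟫} with hG
  have conv : ∀ q : H × H × ℝ,
      Convex ℝ {p : H × H × ℝ | 0 ≤ p.2.2 + q.2.2 - ⟪p.1, q.2.1⟫ - ⟪q.1, p.2.1⟫} := by
    intro q p hp p' hp' s t hs ht hst
    simp only [Set.mem_ofPred_eq, Prod.fst_add, Prod.snd_add, Prod.smul_fst, Prod.smul_snd,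
      inner_add_left, inner_add_right, real_inner_smul_left, real_inner_smul_right,
      smul_eq_mul] at *
    have h1 := mul_nonneg hs hp
    have h2 := mul_nonneg ht hp'
    have h3 : q.2.2 = s * q.2.2 + t * q.2.2 := by rw [← add_mul, hst, one_mul]
    rw [h3]
    linarith
  have step : ∀ q ∈ G, ∀ p ∈ convexHull ℝ G,
      0 ≤ p.2.2 + q.2.2 - ⟪p.1, q.2.1⟫ - ⟪q.1, p.2.1⟫ := by
    intro q hq p hp
    refine convexHull_min ?_ (conv q) hp
    intro r hr
    have := mono r.1 r.2.1 q.1 q.2.1 hr.1 hq.1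
    simp only [inner_sub_left, inner_sub_right] at this
    simp only [Set.mem_ofPred_eq, hr.2, hq.2]
    linarith
  have full := convexHull_min (s := G) (fun q hq => by
    have := step q hq p hp
    simp only [Set.mem_ofPred_eq]
    linarith) (conv p) hp
  simp only [Set.mem_ofPred_eq] at full
  linarith

variable [CompleteSpace H]

lemma exists_neg_mem_of_maximal_monotone {M : H → Set H}
    (mono : ∀ a u b v, u ∈ M a → v ∈ M b → 0 ≤ ⟪a - b, u - v⟫)
    (maxi : ∀ a u, (∀ b v, v ∈ M b → 0 ≤ ⟪a - b, u - v⟫) → u ∈ M a) :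
    ∃ x, -x ∈ M x := by
  set G : Set (H × H × ℝ) := {q | q.2.1 ∈ M q.1 ∧ q.2.2 = ⟪q.1, q.2.1⟫} with hG
  set K := convexHull ℝ G with hK
  have hKconv : Convex ℝ K := convex_convexHull ℝ G
  let φ : H × H × ℝ → ℝ := fun p => p.2.2 + (‖p.1‖ ^ 2 + ‖p.2.1‖ ^ 2) / 2
  have hKne : K.Nonempty := by
    rw [hK, convexHull_nonempty_iff]
    by_contra hne
    have h0 : (0 : H) ∈ M 0 := maxi 0 0 fun b v hv => (hne ⟨(b, v, ⟪b, v⟫), hv, rfl⟩).elim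
    exact hne ⟨(0, 0, ⟪(0 : H), (0 : H)⟫), h0, rfl⟩
  have hφ0 : ∀ p ∈ K, 0 ≤ φ p := by
    intro p hp
    have h1 := inner_le_of_mem_convexHull_graph mono hp
    have h2 := norm_add_sq_real p.1 p.2.1
    have h3 := sq_nonneg ‖p.1 + p.2.1‖
    simp only [φ]
    linarith
  have hbdd : BddBelow (φ '' K) := ⟨0, by rintro _ ⟨p, hp, rfl⟩; exact hφ0 p hp⟩
  set m := sInf (φ '' K) with hm
  have hmle : ∀ p ∈ K, m ≤ φ p := fun p hp => csInf_le hbdd ⟨p, hp, rfl⟩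
  obtain ⟨s, -, hslim, hsmem⟩ := exists_seq_tendsto_sInf (hKne.image φ) hbdd
  choose p hpK hps using hsmem
  have hlim : Tendsto (fun k => φ (p k)) atTop (𝓝 m) := by simpa only [hps] using hslim
  have hpar : ∀ k l, ‖(p k).1 - (p l).1‖ ^ 2 + ‖(p k).2.1 - (p l).2.1‖ ^ 2 ≤
      4 * (φ (p k) - m) + 4 * (φ (p l) - m) := by
    intro k l
    have h1 := hmle _ (hKconv (hpK k) (hpK l) (a := 1 / 2) (b := 1 / 2) (by norm_num)
      (by norm_num) (by norm_num))
    simp only [φ, Prod.fst_add, Prod.snd_add, Prod.smul_fst, Prod.smul_snd, ← smul_add,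
      norm_smul, smul_eq_mul, mul_pow, norm_add_sq_real] at h1 ⊢
    rw [norm_sub_sq_real, norm_sub_sq_real]
    norm_num at h1
    linarith
  have hsmall : ∀ e > 0, ∃ N, ∀ k ≥ N, 4 * (φ (p k) - m) + 4 * (φ (p N) - m) < e := by
    intro e he
    have h := hlim.eventually (gt_mem_nhds (show m < m + e / 8 by linarith))
    obtain ⟨N, hN⟩ := eventually_atTop.1 h
    exact ⟨N, fun k hk => by linarith [hN k hk, hN N le_rfl]⟩
  have hc1 : CauchySeq fun k => (p k).1 := by
    refine Metric.cauchySeq_iff'.2 fun e he => ?_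
    obtain ⟨N, hN⟩ := hsmall (e ^ 2) (by positivity)
    refine ⟨N, fun k hk => ?_⟩
    rw [dist_eq_norm]
    refine lt_of_pow_lt_pow_left₀ 2 he.le ?_
    linarith [hN k hk, hpar k N, sq_nonneg ‖(p k).2.1 - (p N).2.1‖]
  have hc2 : CauchySeq fun k => (p k).2.1 := by
    refine Metric.cauchySeq_iff'.2 fun e he => ?_
    obtain ⟨N, hN⟩ := hsmall (e ^ 2) (by positivity)
    refine ⟨N, fun k hk => ?_⟩
    rw [dist_eq_norm]
    refine lt_of_pow_lt_pow_left₀ 2 he.le ?_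
    linarith [hN k hk, hpar k N, sq_nonneg ‖(p k).1 - (p N).1‖]
  obtain ⟨b, hb⟩ := cauchySeq_tendsto_of_complete hc1
  obtain ⟨v, hv⟩ := cauchySeq_tendsto_of_complete hc2
  obtain ⟨r, hr⟩ : ∃ r, r = m - (‖b‖ ^ 2 + ‖v‖ ^ 2) / 2 := ⟨_, rfl⟩
  have hrlim : Tendsto (fun k => (p k).2.2) atTop (𝓝 r) := by
    have h := hlim.sub (((hb.norm.pow 2).add (hv.norm.pow 2)).div_const 2)
    rw [hr]
    refine h.congr fun k => ?_
    simp [φ]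
  have hbvr : ⟪b, v⟫ ≤ r :=
    le_of_tendsto_of_tendsto' (hb.inner hv) hrlim fun k =>
      inner_le_of_mem_convexHull_graph mono (hpK k)
  have hopt : ∀ b' v', v' ∈ M b' → 0 ≤ ⟪b', v'⟫ - r + ⟪b, b' - b⟫ + ⟪v, v' - v⟫ := by
    intro b' v' hv'
    have hq : ((b', v', ⟪b', v'⟫) : H × H × ℝ) ∈ K := subset_convexHull ℝ G ⟨hv', rfl⟩
    have key : ∀ t : ℝ, 0 < t → t < 1 → 0 ≤ ⟪b', v'⟫ - r + ⟪b, b' - b⟫ + ⟪v, v' - v⟫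
        + t * ((‖b' - b‖ ^ 2 + ‖v' - v‖ ^ 2) / 2) := by
      intro t ht0 ht1
      have h1 : ∀ k, m ≤ φ ((1 - t) • p k + t • (b', v', ⟪b', v'⟫)) := fun k =>
        hmle _ (hKconv (hpK k) hq (by linarith) ht0.le (by ring))
      simp only [φ, Prod.fst_add, Prod.snd_add, Prod.smul_fst, Prod.smul_snd, smul_eq_mul] at h1
      have h2 := ge_of_tendsto' ((((hrlim.const_mul (1 - t)).add_const (t * ⟪b', v'⟫)).add
        (((((hb.const_smul (1 - t)).add_const (t • b')).norm.pow 2).add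
        (((hv.const_smul (1 - t)).add_const (t • v')).norm.pow 2)).div_const 2))) h1
      have e1 : (1 - t) • b + t • b' = b + t • (b' - b) := by module
      have e2 : (1 - t) • v + t • v' = v + t • (v' - v) := by module
      rw [e1, e2, norm_add_sq_real, norm_add_sq_real, norm_smul, norm_smul,
        real_inner_smul_right, real_inner_smul_right, mul_pow, mul_pow, Real.norm_eq_abs,
        sq_abs] at h2
      refine (mul_nonneg_iff_of_pos_left ht0).1 ?_
      nlinarith [hr]
    have hcont : Tendsto (fun t : ℝ => ⟪b', v'⟫ - r + ⟪b, b' - b⟫ + ⟪v, v' - v⟫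
        + t * ((‖b' - b‖ ^ 2 + ‖v' - v‖ ^ 2) / 2)) (𝓝[>] 0)
        (𝓝 (⟪b', v'⟫ - r + ⟪b, b' - b⟫ + ⟪v, v' - v⟫
        + 0 * ((‖b' - b‖ ^ 2 + ‖v' - v‖ ^ 2) / 2))) :=
      tendsto_nhdsWithin_of_tendsto_nhds (Continuous.tendsto (by fun_prop) 0)
    have := ge_of_tendsto hcont (by
      filter_upwards [Ioo_mem_nhdsGT (show (0 : ℝ) < 1 by norm_num)] with t ht
      exact key t ht.1 ht.2)
    simpa using this
  have hgap : ∀ b' v', v' ∈ M b' → ‖b + v‖ ^ 2 ≤ ⟪-v - b', -b - v'⟫ := by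
    intro b' v' hv'
    have h1 := hopt b' v' hv'
    rw [norm_add_sq_real]
    simp only [inner_sub_left, inner_sub_right, inner_neg_left, inner_neg_right,
      real_inner_self_eq_norm_sq] at h1 ⊢
    linarith [real_inner_comm b b', real_inner_comm v b]
  have hmem : -b ∈ M (-v) := maxi _ _ fun b' v' hv' =>
    (sq_nonneg _).trans (hgap b' v' hv')
  have h0 := hgap _ _ hmem
  simp only [sub_self, inner_zero_left] at h0
  have h1 : b + v = 0 := by
    rw [← norm_eq_zero]
    exact pow_eq_zero_iff (two_ne_zero) |>.1 (le_antisymm h0 (sq_nonneg _))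
  rw [← eq_neg_of_add_eq_zero_left h1] at hmem
  exact ⟨b, hmem⟩

/-- Minty's theorem: `M` maximally monotone implies that `Id + l M` is surjective for `l > 0`. -/
lemma exists_inv_smul_sub_mem_of_maximal_monotone {M : H → Set H}
    (mono : ∀ a u b v, u ∈ M a → v ∈ M b → 0 ≤ ⟪a - b, u - v⟫)
    (maxi : ∀ a u, (∀ b v, v ∈ M b → 0 ≤ ⟪a - b, u - v⟫) → u ∈ M a)
    {l : ℝ} (hl : 0 < l) (w : H) : ∃ x, l⁻¹ • (w - x) ∈ M x := by
  have hl' : 0 < l⁻¹ := inv_pos.2 hl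
  obtain ⟨x, hx⟩ := exists_neg_mem_of_maximal_monotone (M := fun x => {u | l⁻¹ • (w + u) ∈ M x})
    (fun a u b v hu hv => by
      have h := mono a _ b _ hu hv
      rw [← smul_sub, real_inner_smul_right, add_sub_add_left_eq_sub] at h
      exact nonneg_of_mul_nonneg_right h hl')
    (fun a u h => maxi _ _ fun b v hv => by
      have h1 := h b (l • v - w) (by
        simp only [Set.mem_ofPred_eq, add_sub_cancel]
        rwa [inv_smul_smul₀ hl.ne'])
      have e : l⁻¹ • (w + u) - v = l⁻¹ • (u - (l • v - w)) := by
        rw [smul_sub, smul_sub, inv_smul_smul₀ hl.ne', smul_add]; abel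
      rw [e, real_inner_smul_right]
      exact mul_nonneg hl'.le h1)
  exact ⟨x, by simpa [sub_eq_add_neg] using hx⟩

/-- The sum of a maximally monotone operator and a Lipschitz operator inherits the maximality
property. -/
lemma neg_mem_of_maximal_monotone_add_lipschitz {M : H → Set H}
    (mono : ∀ a u b v, u ∈ M a → v ∈ M b → 0 ≤ ⟪a - b, u - v⟫)
    (maxi : ∀ a u, (∀ b v, v ∈ M b → 0 ≤ ⟪a - b, u - v⟫) → u ∈ M a)
    {C : H → H} {κ : ℝ} (hκ : 0 ≤ κ) (hC : ∀ a b, ‖C a - C b‖ ≤ κ * ‖a - b‖) {z : H}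
    (hz : ∀ b v, v ∈ M b → 0 ≤ ⟪z - b, -(v + C b)⟫) : -C z ∈ M z := by
  obtain ⟨l, hl, hlκ⟩ : ∃ l : ℝ, 0 < l ∧ l * κ < 1 :=
    ⟨(κ + 1)⁻¹, by positivity, by rw [inv_mul_lt_iff₀ (by positivity)]; linarith⟩
  have hl' : 0 < l⁻¹ := inv_pos.2 hl
  choose J hJ using exists_inv_smul_sub_mem_of_maximal_monotone mono maxi hl
  have hJne : ∀ a b, ‖J a - J b‖ ≤ ‖a - b‖ := by
    intro a b
    have h := mono _ _ _ _ (hJ a) (hJ b)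
    rw [← smul_sub, real_inner_smul_right] at h
    have h1 := nonneg_of_mul_nonneg_right h hl'
    have e : a - J a - (b - J b) = (a - b) - (J a - J b) := by abel
    rw [e, inner_sub_right, real_inner_self_eq_norm_sq] at h1
    have h2 := real_inner_le_norm (J a - J b) (a - b)
    by_contra! hlt
    nlinarith [norm_nonneg (a - b)]
  have hctr : ContractingWith (l * κ).toNNReal fun b => J (z - l • C b) := by
    refine ⟨by simpa using hlκ, LipschitzWith.of_dist_le_mul fun a b => ?_⟩
    rw [dist_eq_norm, dist_eq_norm]
    refine (hJne _ _).trans ?_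
    rw [sub_sub_sub_cancel_left, ← smul_sub, norm_smul, Real.norm_of_nonneg hl.le, norm_sub_rev]
    have := mul_le_mul_of_nonneg_left (hC a b) hl.le
    rw [Real.coe_toNNReal _ (by positivity), mul_assoc]
    exact this
  obtain ⟨b, hb⟩ : ∃ b, J (z - l • C b) = b := ⟨_, hctr.fixedPoint_isFixedPt⟩
  have hmem := hJ (z - l • C b)
  rw [hb] at hmem
  have h1 := hz _ _ hmem
  have e : -(l⁻¹ • (z - l • C b - b) + C b) = -(l⁻¹ • (z - b)) := by
    rw [sub_right_comm, smul_sub, inv_smul_smul₀ hl.ne']; abel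
  rw [e, inner_neg_right, real_inner_smul_right, real_inner_self_eq_norm_sq] at h1
  have h2 : ‖z - b‖ ^ 2 = 0 := by
    refine le_antisymm ?_ (sq_nonneg _)
    by_contra! hlt
    linarith [mul_pos hl' hlt]
  have h3 : z = b := sub_eq_zero.1 (norm_eq_zero.1 (pow_eq_zero_iff two_ne_zero |>.1 h2))
  subst h3
  have e2 : l⁻¹ • (z - l • C z - z) = -C z := by
    rw [sub_right_comm, sub_self, zero_sub, smul_neg, inv_smul_smul₀ hl.ne']
  rwa [e2] at hmem

end MonotoneOperators

section WeakLimits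

variable {H : Type*} [NormedAddCommGroup H] [InnerProductSpace ℝ H]

/-- Bounded families converge weakly along ultrafilters. -/
lemma exists_weak_limit_ultrafilter [CompleteSpace H] {ι : Type*} (U : Ultrafilter ι) {z : ι → H}
    {R : ℝ} (hR : ∀ n, ‖z n‖ ≤ R) :
    ∃ zbar, ∀ w, Tendsto (fun n => ⟪z n, w⟫) U (𝓝 ⟪zbar, w⟫) := by
  have hbd : ∀ w n, |⟪z n, w⟫| ≤ R * ‖w‖ := fun w n =>
    (abs_real_inner_le_norm _ _).trans (mul_le_mul_of_nonneg_right (hR n) (norm_nonneg w))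
  have hex : ∀ w, ∃ y, Tendsto (fun n => ⟪z n, w⟫) U (𝓝 y) := by
    intro w
    obtain ⟨y, -, hy⟩ := (isCompact_Icc (a := -(R * ‖w‖)) (b := R * ‖w‖)).ultrafilter_le_nhds
      (U.map fun n => ⟪z n, w⟫)
      (le_principal_iff.2 (mem_map.2 (Eventually.of_forall fun n => abs_le.1 (hbd w n))))
    exact ⟨y, hy⟩
  choose f hf using hex
  let F : H →ₗ[ℝ] ℝ :=
    { toFun := f
      map_add' := fun a b => tendsto_nhds_unique (hf (a + b))
        (((hf a).add (hf b)).congr fun n => (inner_add_right _ _ _).symm)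
      map_smul' := fun c a => tendsto_nhds_unique (hf (c • a))
        (((hf a).const_mul c).congr fun n => (real_inner_smul_right _ _ _).symm) }
  let F' : H →L[ℝ] ℝ := F.mkContinuous R fun w =>
    le_of_tendsto' (hf w).norm (hbd w)
  refine ⟨(InnerProductSpace.toDual ℝ H).symm F', fun w => ?_⟩
  rw [InnerProductSpace.toDual_symm_apply]
  exact hf w

lemma mem_of_weak_limit [CompleteSpace H] {ι : Type*} {l : Filter ι} [l.NeBot] {X : Set H}
    (hXcl : IsClosed X) (hXconv : Convex ℝ X) {z : ι → H} (hz : ∀ n, z n ∈ X) {zbar : H}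
    (hlim : ∀ w, Tendsto (fun n => ⟪z n, w⟫) l (𝓝 ⟪zbar, w⟫)) : zbar ∈ X := by
  obtain ⟨i⟩ : Nonempty ι := l.nonempty_of_neBot
  obtain ⟨p, hpX, hp⟩ := exists_norm_eq_iInf_of_complete_convex ⟨z i, hz i⟩ hXcl.isComplete
    hXconv zbar
  rw [norm_eq_iInf_iff_real_inner_le_zero hXconv hpX] at hp
  have h := le_of_tendsto' (hlim (zbar - p)) (b := ⟪p, zbar - p⟫) fun n => by
    have := hp (z n) (hz n)
    rw [inner_sub_right, real_inner_comm, real_inner_comm p] at this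
    linarith
  have h0 : ⟪zbar - p, zbar - p⟫ ≤ 0 := by rw [inner_sub_left]; linarith
  rwa [sub_eq_zero.1 (real_inner_self_nonpos.1 h0)]

/-- Opial's lemma, with weak cluster points taken along ultrafilters. -/
lemma exists_weak_limit_of_fejer [CompleteSpace H] {Z : Set H} (hZ : Z.Nonempty) {z : ℕ → H}
    (hfejer : ∀ p ∈ Z, Antitone fun n => ‖z n - p‖ ^ 2)
    (hcluster : ∀ (U : Ultrafilter ℕ) (zbar : H), (U : Filter ℕ) ≤ atTop →
      (∀ w, Tendsto (fun n => ⟪z n, w⟫) U (𝓝 ⟪zbar, w⟫)) → zbar ∈ Z) :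
    ∃ zbar ∈ Z, ∀ w, Tendsto (fun n => ⟪z n, w⟫) atTop (𝓝 ⟪zbar, w⟫) := by
  obtain ⟨p₀, hp₀⟩ := hZ
  have hR : ∀ n, ‖z n‖ ≤ ‖z 0 - p₀‖ + ‖p₀‖ := by
    intro n
    have h1 : ‖z n - p₀‖ ≤ ‖z 0 - p₀‖ :=
      le_of_sq_le_sq (hfejer p₀ hp₀ (Nat.zero_le n)) (norm_nonneg _)
    have h2 := norm_add_le (z n - p₀) p₀
    rw [sub_add_cancel] at h2
    linarith
  have hconv : ∀ p ∈ Z, ∃ y, Tendsto (fun n => ‖z n - p‖ ^ 2) atTop (𝓝 y) := fun p hp =>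
    ⟨_, tendsto_atTop_ciInf (hfejer p hp) ⟨0, by rintro _ ⟨n, rfl⟩; positivity⟩⟩
  have huniq : ∀ (U V : Ultrafilter ℕ) (p q : H), (U : Filter ℕ) ≤ atTop →
      (V : Filter ℕ) ≤ atTop → (∀ w, Tendsto (fun n => ⟪z n, w⟫) U (𝓝 ⟪p, w⟫)) →
      (∀ w, Tendsto (fun n => ⟪z n, w⟫) V (𝓝 ⟪q, w⟫)) → p = q := by
    intro U V p q hU hV hp hq
    obtain ⟨y, hy⟩ := hconv p (hcluster U p hU hp)
    obtain ⟨y', hy'⟩ := hconv q (hcluster V q hV hq)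
    have h : Tendsto (fun n => ⟪z n, p - q⟫) atTop
        (𝓝 ((y' - y + ‖p‖ ^ 2 - ‖q‖ ^ 2) / 2)) := by
      refine ((((hy'.sub hy).add_const (‖p‖ ^ 2)).sub_const (‖q‖ ^ 2)).div_const 2).congr ?_
      intro n
      rw [norm_sub_sq_real, norm_sub_sq_real, inner_sub_right]
      ring
    have h1 := tendsto_nhds_unique (hp (p - q)) (h.mono_left hU)
    have h2 := tendsto_nhds_unique (hq (p - q)) (h.mono_left hV)
    have h3 : ⟪p - q, p - q⟫ = 0 := by rw [inner_sub_left, h1, h2, sub_self]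
    exact sub_eq_zero.1 (inner_self_eq_zero.1 h3)
  obtain ⟨zbar, hzbar⟩ := exists_weak_limit_ultrafilter (Ultrafilter.of atTop) hR
  have hle := Ultrafilter.of_le (atTop : Filter ℕ)
  refine ⟨zbar, hcluster _ _ hle hzbar, fun w => ?_⟩
  rw [tendsto_iff_ultrafilter]
  intro V hV
  obtain ⟨q, hq⟩ := exists_weak_limit_ultrafilter V hR
  rw [huniq _ V zbar q hle hV hzbar hq]
  exact hq w

end WeakLimits

section ForwardBackward

variable {H : Type*} [NormedAddCommGroup H] [InnerProductSpace ℝ H]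

lemma norm_add_sq_le_of_cocoercive {a d e D : H} {β γ ε κ : ℝ} (hε : 0 < ε) (hγ : 0 < γ)
    (hγβ : γ ≤ 2 * β * ε) (h : 0 ≤ ⟪a, d - e - γ • D⟫) (hD : β * ‖D‖ ^ 2 ≤ ⟪a + d, D⟫)
    (he : ‖e‖ ≤ κ * ‖d‖) :
    ‖a + e‖ ^ 2 ≤ ‖a + d‖ ^ 2 - (1 - ε - κ ^ 2) * ‖d‖ ^ 2 := by
  have h1 : ‖e‖ ^ 2 ≤ κ ^ 2 * ‖d‖ ^ 2 := by
    rw [← mul_pow]; exact pow_le_pow_left₀ (norm_nonneg e) he 2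
  have h2 := sq_nonneg ‖ε • d - γ • D‖
  rw [norm_sub_sq_real, norm_smul, norm_smul, mul_pow, mul_pow, Real.norm_eq_abs, Real.norm_eq_abs,
    sq_abs, sq_abs, real_inner_smul_left, real_inner_smul_right] at h2
  simp only [inner_sub_right, inner_add_left, real_inner_smul_right] at h hD
  have h3 : γ * (γ * ‖D‖ ^ 2) ≤ γ * (2 * β * ε * ‖D‖ ^ 2) := by gcongr
  have h4 : 2 * γ * ⟪d, D⟫ ≤ ε * ‖d‖ ^ 2 + 2 * β * γ * ‖D‖ ^ 2 := by
    refine le_of_mul_le_mul_left ?_ hε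
    nlinarith
  have h5 := mul_le_mul_of_nonneg_left hD hγ.le
  rw [norm_add_sq_real, norm_add_sq_real]
  nlinarith

lemma norm_sub_sq_le_of_inner_nonpos {y p c : H} (h : ⟪y - p, c - p⟫ ≤ 0) :
    ‖p - c‖ ^ 2 ≤ ‖y - c‖ ^ 2 := by
  have e : y - c = (y - p) - (c - p) := by abel
  rw [norm_sub_rev p c, e, norm_sub_sq_real (y - p)]
  nlinarith [sq_nonneg ‖y - p‖]

end ForwardBackward

/-- Weak convergence of the forward–backward–half-forward method with line
search, under the condition `liminf γₙ > 0`. -/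
theorem stmt_8 {H : Type*} [NormedAddCommGroup H] [InnerProductSpace ℝ H]
    [CompleteSpace H]
    (A : H → Set H)
    (hAmono : ∀ a u b v, u ∈ A a → v ∈ A b → 0 ≤ ⟪a - b, u - v⟫)
    (hAmax : ∀ a u, (∀ b v, v ∈ A b → 0 ≤ ⟪a - b, u - v⟫) → u ∈ A a)
    (β L : ℝ) (hβ : 0 < β) (hL : 0 < L)
    (B₁ B₂ B₃ : H → H)
    (hB₁ : ∀ a b : H, β * ‖B₁ a - B₁ b‖ ^ 2 ≤ ⟪a - b, B₁ a - B₁ b⟫)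
    (hB₂mono : ∀ a b : H, 0 ≤ ⟪a - b, B₂ a - B₂ b⟫)
    (hB₂lip : ∀ a b : H, ‖B₂ a - B₂ b‖ ≤ L * ‖a - b‖)
    (X : Set H) (hXne : X.Nonempty) (hXcl : IsClosed X) (hXconv : Convex ℝ X)
    (hB₃mono : ∀ a b, a ∈ {w : H | (A w).Nonempty} ∪ X →
      b ∈ {w : H | (A w).Nonempty} ∪ X → 0 ≤ ⟪a - b, B₃ a - B₃ b⟫)
    (hsum_mono : ∀ a u b v, u ∈ A a → v ∈ A b →
      0 ≤ ⟪a - b, (u + B₃ a) - (v + B₃ b)⟫)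
    (hsum_max : ∀ a u, (∀ b v, v ∈ A b → 0 ≤ ⟪a - b, u - (v + B₃ b)⟫) →
      u - B₃ a ∈ A a)
    (hZne : ∃ w ∈ X, -(B₁ w + B₂ w + B₃ w) ∈ A w)
    (ε : ℝ) (hε : ε ∈ Set.Ioo (0 : ℝ) 1)
    (ρ : ℝ) (hρ : ρ = min (2 * β * ε) (Real.sqrt (1 - ε) / L))
    (σ : ℝ) (hσ : σ ∈ Set.Ioo (0 : ℝ) 1)
    (θ : ℝ) (hθ : θ ∈ Set.Ioo (0 : ℝ) (Real.sqrt (1 - ε) - L * ρ * σ))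
    (zseq xseq : ℕ → H) (γseq : ℕ → ℝ)
    (hz0 : zseq 0 ∈ X)
    (hγ : ∀ n, γseq n ∈ Set.Ioc (0 : ℝ) (ρ * σ))
    (hres : ∀ n, zseq n - γseq n • (B₁ (zseq n) + B₂ (zseq n) + B₃ (zseq n))
      - xseq n ∈ γseq n • A (xseq n))
    (hls : ∀ n, γseq n * ‖B₃ (zseq n) - B₃ (xseq n)‖ ≤ θ * ‖zseq n - xseq n‖)
    (hprojX : ∀ n, zseq (n + 1) ∈ X)
    (hproj : ∀ n, ∀ c ∈ X,
      ⟪xseq n + γseq n • ((B₂ (zseq n) + B₃ (zseq n)) - (B₂ (xseq n) + B₃ (xseq n)))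
        - zseq (n + 1), c - zseq (n + 1)⟫ ≤ 0)
    (hliminf : ∃ δ > (0 : ℝ), ∃ N : ℕ, ∀ n ≥ N, δ ≤ γseq n) :
    ∃ zbar, zbar ∈ X ∧ -(B₁ zbar + B₂ zbar + B₃ zbar) ∈ A zbar ∧
      ∀ w : H, Filter.Tendsto (fun n => ⟪zseq n, w⟫) Filter.atTop (nhds ⟪zbar, w⟫) := by
  obtain ⟨hε0, hε1⟩ := hε
  obtain ⟨hσ0, hσ1⟩ := hσ
  obtain ⟨hθ0, hθ1⟩ := hθ
  obtain ⟨δ, hδ, N, hN⟩ := hliminf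
  have hzX : ∀ n, zseq n ∈ X := fun n => Nat.casesOn n hz0 hprojX
  have hρσ : 0 < ρ * σ := (hγ 0).1.trans_le (hγ 0).2
  have hρ0 : 0 < ρ := pos_of_mul_pos_left hρσ hσ0.le
  have hγβ : ∀ n, γseq n ≤ 2 * β * ε := fun n =>
    (hγ n).2.trans ((mul_le_of_le_one_right hρ0.le hσ1.le).trans (hρ ▸ min_le_left _ _))
  obtain ⟨κ, hκ⟩ : ∃ κ, κ = L * ρ * σ + θ := ⟨_, rfl⟩
  have hκ0 : 0 ≤ κ := by rw [hκ]; positivity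
  have hκε : 0 < 1 - ε - κ ^ 2 := by
    have h1 : κ < Real.sqrt (1 - ε) := by linarith
    have h2 := (Real.lt_sqrt hκ0).1 h1
    linarith
  have hA : ∀ n, ∃ u ∈ A (xseq n), γseq n • u =
      zseq n - γseq n • (B₁ (zseq n) + B₂ (zseq n) + B₃ (zseq n)) - xseq n :=
    fun n => Set.mem_smul_set.1 (hres n)
  choose u huA hu using hA
  have hdecr : ∀ n, ∀ p ∈ X, -(B₁ p + B₂ p + B₃ p) ∈ A p →
      ‖zseq (n + 1) - p‖ ^ 2 ≤
        ‖zseq n - p‖ ^ 2 - (1 - ε - κ ^ 2) * ‖zseq n - xseq n‖ ^ 2 := by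
    intro n p hpX hpA
    refine (norm_sub_sq_le_of_inner_nonpos (hproj n p hpX)).trans ?_
    have hγ0 := (hγ n).1
    set e := γseq n • ((B₂ (zseq n) + B₃ (zseq n)) - (B₂ (xseq n) + B₃ (xseq n))) with he
    have hmono : 0 ≤ ⟪xseq n - p,
        zseq n - xseq n - e - γseq n • (B₁ (zseq n) - B₁ p)⟫ := by
      have h1 := hAmono _ _ _ _ (huA n) hpA
      have h2 := hB₂mono (xseq n) p
      have h3 := hB₃mono (xseq n) p (Or.inl ⟨_, huA n⟩) (Or.inr hpX)
      have h4 := mul_nonneg hγ0.le (add_nonneg h1 (add_nonneg h2 h3))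
      rw [← inner_add_right, ← inner_add_right, ← real_inner_smul_right] at h4
      refine h4.trans_eq (congrArg _ ?_)
      rw [smul_add, smul_sub _ (u n), hu n, he]
      module
    have hcoc : β * ‖B₁ (zseq n) - B₁ p‖ ^ 2 ≤
        ⟪(xseq n - p) + (zseq n - xseq n), B₁ (zseq n) - B₁ p⟫ := by
      rw [add_comm, sub_add_sub_cancel]
      exact hB₁ _ _
    have hnorm : ‖e‖ ≤ κ * ‖zseq n - xseq n‖ := by
      rw [he, add_sub_add_comm, smul_add]
      refine (norm_add_le _ _).trans ?_
      rw [norm_smul, norm_smul, Real.norm_of_nonneg hγ0.le, hκ, add_mul]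
      refine add_le_add ?_ (hls n)
      calc γseq n * ‖B₂ (zseq n) - B₂ (xseq n)‖
          ≤ (ρ * σ) * (L * ‖zseq n - xseq n‖) :=
            mul_le_mul (hγ n).2 (hB₂lip _ _) (norm_nonneg _) hρσ.le
        _ = L * ρ * σ * ‖zseq n - xseq n‖ := by ring
    have h := norm_add_sq_le_of_cocoercive hε0 hγ0 (hγβ n) hmono hcoc hnorm
    rw [add_comm (xseq n - p) (zseq n - xseq n), sub_add_sub_cancel] at h
    rwa [add_sub_right_comm]
  have hanti : ∀ p ∈ {w | w ∈ X ∧ -(B₁ w + B₂ w + B₃ w) ∈ A w},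
      Antitone fun n => ‖zseq n - p‖ ^ 2 := fun p hp =>
    antitone_nat_of_succ_le fun n =>
      (hdecr n p hp.1 hp.2).trans (sub_le_self _ (mul_nonneg hκε.le (sq_nonneg _)))
  obtain ⟨p₀, hp₀X, hp₀A⟩ := hZne
  have hgap : Tendsto (fun n => zseq n - xseq n) atTop (𝓝 0) := by
    have h1 := tendsto_atTop_ciInf (hanti p₀ ⟨hp₀X, hp₀A⟩)
      ⟨0, by rintro _ ⟨n, rfl⟩; positivity⟩
    have h2 := (h1.sub (h1.comp (tendsto_add_atTop_nat 1))).div_const (1 - ε - κ ^ 2)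
    rw [sub_self, zero_div] at h2
    have h3 : Tendsto (fun n => ‖zseq n - xseq n‖ ^ 2) atTop (𝓝 0) := by
      refine squeeze_zero (fun n => sq_nonneg _) (fun n => ?_) h2
      rw [le_div_iff₀ hκε]
      have := hdecr n p₀ hp₀X hp₀A
      simp only [Function.comp_apply]
      linarith
    have h4 := h3.sqrt
    simp only [Real.sqrt_zero, Real.sqrt_sq (norm_nonneg _)] at h4
    exact tendsto_zero_iff_norm_tendsto_zero.2 h4
  have hB₁lip : ∀ a b, ‖B₁ a - B₁ b‖ ≤ β⁻¹ * ‖a - b‖ := by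
    intro a b
    rw [le_inv_mul_iff₀ hβ]
    by_contra! hlt
    have h1 := (hB₁ a b).trans (real_inner_le_norm _ _)
    have h2 : 0 < ‖B₁ a - B₁ b‖ :=
      pos_of_mul_pos_right ((norm_nonneg _).trans_lt hlt) hβ.le
    nlinarith
  have hClip : ∀ a b, ‖(B₁ a + B₂ a) - (B₁ b + B₂ b)‖ ≤ (β⁻¹ + L) * ‖a - b‖ := by
    intro a b
    rw [add_sub_add_comm, add_mul]
    exact (norm_add_le _ _).trans (add_le_add (hB₁lip a b) (hB₂lip a b))
  have hres0 : Tendsto (fun n => u n + B₃ (xseq n) + (B₁ (xseq n) + B₂ (xseq n))) atTop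
      (𝓝 0) := by
    have hb : Tendsto (fun n => (δ⁻¹ + (β⁻¹ + L) + θ / δ) * ‖zseq n - xseq n‖) atTop (𝓝 0) := by
      simpa using hgap.norm.const_mul (δ⁻¹ + (β⁻¹ + L) + θ / δ)
    refine squeeze_zero_norm' (eventually_atTop.2 ⟨N, fun n hn => ?_⟩) hb
    have hγ0 := (hγ n).1
    have hγδ := hN n hn
    have e : u n + B₃ (xseq n) + (B₁ (xseq n) + B₂ (xseq n)) =
        (γseq n)⁻¹ • (zseq n - xseq n)
          - ((B₁ (zseq n) + B₂ (zseq n)) - (B₁ (xseq n) + B₂ (xseq n)))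
          - (B₃ (zseq n) - B₃ (xseq n)) := by
      have h1 : u n = (γseq n)⁻¹ • (zseq n - xseq n)
          - (B₁ (zseq n) + B₂ (zseq n) + B₃ (zseq n)) := by
        rw [← inv_smul_smul₀ hγ0.ne' (u n), hu n, sub_right_comm, smul_sub,
          inv_smul_smul₀ hγ0.ne']
      rw [h1]
      abel
    have h3 : ‖B₃ (zseq n) - B₃ (xseq n)‖ ≤ θ / δ * ‖zseq n - xseq n‖ := by
      rw [div_mul_eq_mul_div, le_div_iff₀ hδ, mul_comm]
      exact (mul_le_mul_of_nonneg_right hγδ (norm_nonneg _)).trans (hls n)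
    have h4 : ‖(γseq n)⁻¹ • (zseq n - xseq n)‖ ≤ δ⁻¹ * ‖zseq n - xseq n‖ := by
      rw [norm_smul, Real.norm_of_nonneg (inv_nonneg.2 hγ0.le)]
      gcongr
    rw [e, add_mul, add_mul]
    exact (norm_sub_le _ _).trans
      (add_le_add ((norm_sub_le _ _).trans (add_le_add h4 (hClip _ _))) h3)
  have hxbdd : ∃ R, ∀ n, ‖xseq n‖ ≤ R := by
    obtain ⟨R, hR⟩ := hgap.norm.bddAbove_range
    refine ⟨R + (‖zseq 0 - p₀‖ + ‖p₀‖), fun n => ?_⟩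
    have h1 : ‖zseq n - p₀‖ ≤ ‖zseq 0 - p₀‖ :=
      le_of_sq_le_sq (hanti p₀ ⟨hp₀X, hp₀A⟩ (Nat.zero_le n)) (norm_nonneg _)
    have h2 : ‖zseq n - xseq n‖ ≤ R := hR ⟨n, rfl⟩
    have e : xseq n = (zseq n - p₀) + p₀ - (zseq n - xseq n) := by abel
    have h3 := (norm_sub_le (zseq n - p₀ + p₀) (zseq n - xseq n)).trans
      (add_le_add_left (norm_add_le (zseq n - p₀) p₀) _)
    rw [← e] at h3
    linarith
  obtain ⟨R, hR⟩ := hxbdd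
  obtain ⟨zbar, ⟨hzbarX, hzbarA⟩, hlim⟩ := exists_weak_limit_of_fejer
    (Z := {w | w ∈ X ∧ -(B₁ w + B₂ w + B₃ w) ∈ A w}) ⟨p₀, hp₀X, hp₀A⟩ hanti (by
      intro U zbar hU hz
      refine ⟨mem_of_weak_limit hXcl hXconv hzX hz, ?_⟩
      have hx : ∀ w, Tendsto (fun n => ⟪xseq n, w⟫) U (𝓝 ⟪zbar, w⟫) := by
        intro w
        have h := (hz w).sub ((hgap.mono_left hU).inner (tendsto_const_nhds (x := w)))
        rw [inner_zero_left, sub_zero] at h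
        refine h.congr fun n => ?_
        rw [← inner_sub_left, sub_sub_cancel]
      have hM := neg_mem_of_maximal_monotone_add_lipschitz
        (M := fun x => {s | s - B₃ x ∈ A x}) (C := fun x => B₁ x + B₂ x) (κ := β⁻¹ + L)
        (z := zbar)
        (fun a s b t hs ht => by simpa using hsum_mono a _ b _ hs ht)
        (fun a s h => hsum_max a s fun b v hv => h b _ (by simpa using hv))
        (by positivity) hClip
        (fun b v hv => by
          have h1 : Tendsto (fun n => ⟪xseq n - b,
              u n + B₃ (xseq n) + (B₁ (xseq n) + B₂ (xseq n))⟫) U (𝓝 0) := by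
            have h2 : Tendsto (fun n => (R + ‖b‖) *
                ‖u n + B₃ (xseq n) + (B₁ (xseq n) + B₂ (xseq n))‖) U (𝓝 0) := by
              simpa using ((hres0.mono_left hU).norm.const_mul (R + ‖b‖))
            refine squeeze_zero_norm (fun n => ?_) h2
            refine (norm_inner_le_norm _ _).trans ?_
            gcongr
            exact (norm_sub_le _ _).trans (by gcongr; exact hR n)
          have h3 := h1.sub ((hx (v + (B₁ b + B₂ b))).sub_const ⟪b, v + (B₁ b + B₂ b)⟫)
          have h4 := ge_of_tendsto' h3 (b := 0) fun n => by
            have m1 := hsum_mono _ _ _ _ (huA n) hv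
            have m2 := (mul_nonneg hβ.le (sq_nonneg _)).trans (hB₁ (xseq n) b)
            have m3 := hB₂mono (xseq n) b
            have m4 := add_nonneg m1 (add_nonneg m2 m3)
            rw [← inner_add_right, ← inner_add_right] at m4
            rw [← inner_sub_left, ← inner_sub_right]
            refine m4.trans_eq (congrArg _ ?_)
            abel
          rw [inner_neg_right, inner_sub_left]
          linarith)
      have e : -(B₁ zbar + B₂ zbar + B₃ zbar) = -(B₁ zbar + B₂ zbar) - B₃ zbar := by abel
      rw [e]
      exact hM)
  exact ⟨zbar, hzbarX, hzbarA, hlim⟩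
end

section
/- Let H be a real Hilbert space, let p ∈ ℕ, let U ⊆ H, and for each i ∈ {1,…,p} let eᵢ : H → ℝ and gᵢ : H → H satisfy the subgradient inequality eᵢ(x') ≥ eᵢ(x) + ⟪gᵢ(x), x' − x⟫ for all x, x' ∈ U (as holds when eᵢ is convex and Gâteaux differentiable on U with gradient gᵢ). Then for all x, x' ∈ U and all v, v' ∈ ℝᵖ with vᵢ ≥ 0 and v'ᵢ ≥ 0 for every i, one has ⟪x − x', Σᵢ vᵢ gᵢ(x) − Σᵢ v'ᵢ gᵢ(x')⟫ − Σᵢ (vᵢ − v'ᵢ)(eᵢ(x) − eᵢ(x')) ≥ 0; that is, the saddle operator (x,u,v) ↦ (Σᵢ vᵢ gᵢ(x), 0, −(eᵢ(x))ᵢ) is monotone on U × G × [0,∞)ᵖ for any real Hilbert space G. -/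
open scoped RealInnerProductSpace

/-- The saddle operator `(x,u,v) ↦ (Σᵢ vᵢ gᵢ(x), 0, −(eᵢ(x))ᵢ)` built from
functions satisfying the subgradient inequality is monotone on
`U × G × [0,∞)ᵖ`. -/
theorem stmt_10 {H : Type*} [NormedAddCommGroup H] [InnerProductSpace ℝ H]
    [CompleteSpace H]
    (p : ℕ) (U : Set H) (e : Fin p → H → ℝ) (g : Fin p → H → H)
    (hsub : ∀ i : Fin p, ∀ x ∈ U, ∀ x' ∈ U, e i x + ⟪g i x, x' - x⟫ ≤ e i x') :
    ∀ x ∈ U, ∀ x' ∈ U, ∀ v v' : Fin p → ℝ,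
      (∀ i, 0 ≤ v i) → (∀ i, 0 ≤ v' i) →
      0 ≤ ⟪x - x', (∑ i, v i • g i x) - ∑ i, v' i • g i x'⟫
        - ∑ i, (v i - v' i) * (e i x - e i x') := by
  intro x hx x' hx' v v' hv hv'
  rw [inner_sub_right, inner_sum, inner_sum, ← Finset.sum_sub_distrib, ← Finset.sum_sub_distrib]
  refine Finset.sum_nonneg fun i _ => ?_
  have h := hsub i x hx x' hx'
  have h' := hsub i x' hx' x hx
  rw [← neg_sub x x', inner_neg_right, real_inner_comm] at h
  rw [real_inner_comm] at h'
  rw [real_inner_smul_right, real_inner_smul_right]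
  have hm := mul_le_mul_of_nonneg_left h (hv i)
  have hm' := mul_le_mul_of_nonneg_left h' (hv' i)
  linarith
end
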